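/- Let V be a topological mixed lattice space whose vector topology τ is locally convex. Then τ is locally mixed-full if and only if τ is generated by a family of mixed-monotone seminorms. -/

import Mathlib

/-- A mixed lattice vector space: a real vector space with two partial orders
(the initial order `le` and the specific order `sle`), each making it a partially
ordered vector space, such that the mixed upper and lower envelopes `up` and `down`
exist, `sle` implies `le`, and the specific cone is a mixed lattice cone. -/
structure MixedLattice (V : Type*) [AddCommGroup V] [Module ℝ V] where
  le : V → V → Prop
  sle : V → V → Prop
  le_refl : ∀ x, le x x
  le_trans : ∀ {x y z}, le x y → le y z → le x z
  le_antisymm : ∀ {x y}, le x y → le y x → x = y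
  sle_refl : ∀ x, sle x x
  sle_trans : ∀ {x y z}, sle x y → sle y z → sle x z
  sle_antisymm : ∀ {x y}, sle x y → sle y x → x = y
  le_add : ∀ {x y} (z : V), le x y → le (x + z) (y + z)
  le_smul : ∀ {a : ℝ}, 0 ≤ a → ∀ {x y}, le x y → le (a • x) (a • y)
  sle_add : ∀ {x y} (z : V), sle x y → sle (x + z) (y + z)
  sle_smul : ∀ {a : ℝ}, 0 ≤ a → ∀ {x y}, sle x y → sle (a • x) (a • y)
  /-- the mixed upper envelope `x ⌣ y` -/
  up : V → V → V
  /-- the mixed lower envelope `x ⌢ y` -/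
  down : V → V → V
  up_mem₁ : ∀ x y, sle x (up x y)
  up_mem₂ : ∀ x y, le y (up x y)
  up_min : ∀ x y w, sle x w → le y w → le (up x y) w
  down_mem₁ : ∀ x y, sle (down x y) x
  down_mem₂ : ∀ x y, le (down x y) y
  down_max : ∀ x y w, sle w x → le w y → le w (down x y)
  sle_imp_le : ∀ {x y}, sle x y → le x y
  up_cone : ∀ {x y}, sle 0 x → sle 0 y → sle 0 (up x y)
  down_cone : ∀ {x y}, sle 0 x → sle 0 y → sle 0 (down x y)

namespace MixedLattice

variable {V : Type*} [AddCommGroup V] [Module ℝ V] (M : MixedLattice V)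

/-- the specific upper part `xᵘ = 0 ⌣ x` -/
def supp (x : V) : V := M.up 0 x

/-- the specific lower part `xˡ = 0 ⌣ (-x)` -/
def slowp (x : V) : V := M.up 0 (-x)

/-- the upper part `ᵘx = x ⌣ 0` -/
def upp (x : V) : V := M.up x 0

/-- the lower part `ˡx = (-x) ⌣ 0` -/
def lowp (x : V) : V := M.up (-x) 0

/-- the symmetric generalized absolute value `s(x) = (1/2)((x⌣(−x)) + ((−x)⌣x))` -/
noncomputable def sabs (x : V) : V := (1 / 2 : ℝ) • (M.up x (-x) + M.up (-x) x)

/-- the type 1 mixed-full hull `MF₁(A) = {y : x ≼ y ≤ z for some x, z ∈ A}` -/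
def MF1 (A : Set V) : Set V := {y | ∃ x ∈ A, ∃ z ∈ A, M.sle x y ∧ M.le y z}

/-- the type 2 mixed-full hull `MF₂(A) = {y : x ≤ y ≼ z for some x, z ∈ A}` -/
def MF2 (A : Set V) : Set V := {y | ∃ x ∈ A, ∃ z ∈ A, M.le x y ∧ M.sle y z}

/-- `MS₁(A) = {y : −s(x) ≼ y ≤ s(x) for some x ∈ A}` -/
def MS1 (A : Set V) : Set V := {y | ∃ x ∈ A, M.sle (-M.sabs x) y ∧ M.le y (M.sabs x)}

/-- `MS₂(A) = {y : −s(x) ≤ y ≼ s(x) for some x ∈ A}` -/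
def MS2 (A : Set V) : Set V := {y | ∃ x ∈ A, M.le (-M.sabs x) y ∧ M.sle y (M.sabs x)}

/-- a set is symmetric-solid if `x ∈ A` and `s(y) ≤ s(x)` imply `y ∈ A` -/
def SymmSolid (A : Set V) : Prop := ∀ x ∈ A, ∀ y, M.le (M.sabs y) (M.sabs x) → y ∈ A

/-- a set is (≤)-full if `x, y ∈ S` and `y ≤ z ≤ x` imply `z ∈ S` -/
def LeFull (S : Set V) : Prop := ∀ x ∈ S, ∀ y ∈ S, ∀ z, M.le y z → M.le z x → z ∈ S

/-- a set is (≼)-full if `x, y ∈ S` and `y ≼ z ≼ x` imply `z ∈ S` -/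
def SleFull (S : Set V) : Prop := ∀ x ∈ S, ∀ y ∈ S, ∀ z, M.sle y z → M.sle z x → z ∈ S

/-- a linear subspace, as a set -/
def IsSubspace (S : Set V) : Prop :=
  (0 : V) ∈ S ∧ (∀ x ∈ S, ∀ y ∈ S, x + y ∈ S) ∧ ∀ (a : ℝ), ∀ x ∈ S, a • x ∈ S

/-- a mixed lattice subspace -/
def IsMLSubspace (S : Set V) : Prop :=
  IsSubspace S ∧ ∀ x ∈ S, ∀ y ∈ S, M.up x y ∈ S ∧ M.down x y ∈ S

section Topology

variable [TopologicalSpace V]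

/-- uniform continuity of a map `V → V` with respect to a vector topology -/
def UnifCont (f : V → V) : Prop :=
  ∀ W ∈ nhds (0 : V), ∃ U ∈ nhds (0 : V), ∀ x y : V, x - y ∈ U → f x - f y ∈ W

/-- uniform continuity of a map `V × V → V` with respect to a vector topology -/
def UnifCont2 (g : V → V → V) : Prop :=
  ∀ W ∈ nhds (0 : V), ∃ U ∈ nhds (0 : V),
    ∀ x x' y y' : V, x - x' ∈ U → y - y' ∈ U → g x y - g x' y' ∈ W

/-- the topology is locally mixed-full: every neighborhood of zero contains a
type 1 mixed-full neighborhood of zero -/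
def LocallyMixedFull : Prop :=
  ∀ U ∈ nhds (0 : V), ∃ W ∈ nhds (0 : V), W ⊆ U ∧ M.MF1 W = W

/-- the topology has a neighborhood base at zero of symmetric-solid sets -/
def LocallySymmSolid : Prop :=
  ∀ U ∈ nhds (0 : V), ∃ W ∈ nhds (0 : V), W ⊆ U ∧ M.SymmSolid W

/-- the topology has a neighborhood base at zero of (≤)-full sets -/
def LocallyLeFull : Prop :=
  ∀ U ∈ nhds (0 : V), ∃ W ∈ nhds (0 : V), W ⊆ U ∧ M.LeFull W

/-- the mixed lattice operations are continuous at zero -/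
def ContAtZero : Prop :=
  ContinuousAt (fun p : V × V => M.up p.1 p.2) ((0 : V), (0 : V)) ∧
  ContinuousAt (fun p : V × V => M.down p.1 p.2) ((0 : V), (0 : V))

end Topology

end MixedLattice

namespace MixedLattice

variable {V : Type*} [AddCommGroup V] [Module ℝ V] (M : MixedLattice V)

open Pointwise

theorem le_add_add {a b c d : V} (hab : M.le a b) (hcd : M.le c d) : M.le (a + c) (b + d) :=
  M.le_trans (M.le_add c hab) (by simpa only [add_comm b] using M.le_add b hcd)

theorem le_neg_neg {a b : V} (h : M.le a b) : M.le (-b) (-a) := by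
  simpa [← add_assoc] using M.le_add (-a + -b) h

theorem subset_MF1 (A : Set V) : A ⊆ M.MF1 A :=
  fun x hx => ⟨x, hx, x, hx, M.sle_refl x, M.le_refl x⟩

theorem MF1_mono {A B : Set V} (h : A ⊆ B) : M.MF1 A ⊆ M.MF1 B :=
  fun _ ⟨x, hx, z, hz, hxy, hyz⟩ => ⟨x, h hx, z, h hz, hxy, hyz⟩

theorem MF1_MF1 (A : Set V) : M.MF1 (M.MF1 A) = M.MF1 A := by
  refine Set.Subset.antisymm ?_ (M.subset_MF1 _)
  rintro y ⟨x, ⟨a, ha, -, -, hax, -⟩, z, ⟨-, -, b, hb, -, hzb⟩, hxy, hyz⟩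
  exact ⟨a, ha, b, hb, M.sle_trans hax hxy, M.le_trans hyz hzb⟩

theorem convex_setOf_le_mem {C : Set V} (hC : Convex ℝ C) :
    Convex ℝ {y : V | ∃ c ∈ C, M.le y c} := by
  rintro x ⟨c, hc, hxc⟩ y ⟨d, hd, hyd⟩ a b ha hb hab
  exact ⟨a • c + b • d, hC hc hd ha hb hab, M.le_add_add (M.le_smul ha hxc) (M.le_smul hb hyd)⟩

/-- Every element of the absolutely convex hull of `MF₁(C)` is dominated by an element of `C`. -/
theorem absConvexHull_MF1_subset {C : Set V} (hC : AbsConvex ℝ C) :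
    absConvexHull ℝ (M.MF1 C) ⊆ {y : V | ∃ c ∈ C, M.le y c} := by
  rw [← convexHull_union_neg_eq_absConvexHull]
  refine convexHull_min (Set.union_subset ?_ ?_) (M.convex_setOf_le_mem hC.2)
  · rintro y ⟨-, -, z, hz, -, hyz⟩
    exact ⟨z, hz, hyz⟩
  · rintro y ⟨x, hx, -, -, hxy, -⟩
    exact ⟨-x, hC.1.neg_mem_iff.2 hx, by simpa using M.le_neg_neg (M.sle_imp_le hxy)⟩

theorem mem_absConvexHull_MF1_of_le {C : Set V} (hC : AbsConvex ℝ C) (h0 : (0 : V) ∈ C) {x y : V}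
    (hy : y ∈ absConvexHull ℝ (M.MF1 C)) (hx : M.sle 0 x) (hxy : M.le x y) :
    x ∈ absConvexHull ℝ (M.MF1 C) := by
  obtain ⟨c, hc, hyc⟩ := M.absConvexHull_MF1_subset hC hy
  exact subset_absConvexHull ⟨0, h0, c, hc, hx, M.le_trans hxy hyc⟩

theorem gauge_le_gauge_of_le {E : Set V} (hE : Absorbent ℝ E)
    (hmono : ∀ x y : V, y ∈ E → M.sle 0 x → M.le x y → x ∈ E) {x y : V}
    (hx : M.sle 0 x) (hxy : M.le x y) : gauge E x ≤ gauge E y := by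
  refine le_of_forall_gt_imp_ge_of_dense fun a ha => ?_
  obtain ⟨b, hb, hba, hyb⟩ := exists_lt_of_gauge_lt hE ha
  refine (gauge_le_of_mem hb.le ?_).trans hba.le
  rw [Set.mem_smul_set_iff_inv_smul_mem₀ hb.ne'] at hyb ⊢
  have hb' : 0 ≤ b⁻¹ := inv_nonneg.2 hb.le
  exact hmono _ _ hyb (by simpa using M.sle_smul hb' hx) (M.le_smul hb' hxy)

section Topology

variable [TopologicalSpace V] [ContinuousSMul ℝ V]

theorem LocallyMixedFull.exists_seminorm [IsTopologicalAddGroup V] [LocallyConvexSpace ℝ V]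
    {M : MixedLattice V} (h : M.LocallyMixedFull) {U : Set V} (hU : U ∈ nhds (0 : V)) :
    ∃ p : Seminorm ℝ V, Continuous p ∧ (∀ x y : V, M.sle 0 x → M.le x y → p x ≤ p y) ∧
      {x : V | p x < 1} ⊆ U := by
  obtain ⟨U', ⟨hU', hU'c⟩, hU'U⟩ := (nhds_hasBasis_absConvex ℝ V).mem_iff.1 hU
  obtain ⟨W, hW, hWU, hWfull⟩ := h U' hU'
  obtain ⟨C, ⟨hC, hCc⟩, hCW⟩ := (nhds_hasBasis_absConvex ℝ V).mem_iff.1 hW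
  set E := absConvexHull ℝ (M.MF1 C)
  have hEU : E ⊆ U' := absConvexHull_min ((M.MF1_mono hCW).trans (hWfull.le.trans hWU)) hU'c
  have hE : E ∈ nhds (0 : V) :=
    Filter.mem_of_superset hC ((M.subset_MF1 C).trans subset_absConvexHull)
  have hEabs : Absorbent ℝ E := absorbent_nhds_zero hE
  refine ⟨gaugeSeminorm balanced_absConvexHull convex_absConvexHull hEabs,
    continuous_gauge convex_absConvexHull hE, fun x y hx hxy => ?_, fun x hx => ?_⟩
  · exact M.gauge_le_gauge_of_le hEabs
      (fun _ _ => M.mem_absConvexHull_MF1_of_le hCc (mem_of_mem_nhds hC)) hx hxy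
  · exact hU'U (hEU (setOfPred_gauge_lt_one_subset_self convex_absConvexHull
      (mem_of_mem_nhds hE) hEabs hx))

end Topology

theorem seminorm_lt_of_mem_MF1 {p : Seminorm ℝ V}
    (hp : ∀ x y : V, M.sle 0 x → M.le x y → p x ≤ p y) {A : Set V} {δ : ℝ}
    (hA : ∀ x ∈ A, p x < δ) {y : V} (hy : y ∈ M.MF1 A) : p y < 3 * δ := by
  obtain ⟨x, hx, z, hz, hxy, hyz⟩ := hy
  have hmono : p (y - x) ≤ p (z - x) := hp _ _
    (by simpa [sub_eq_add_neg] using M.sle_add (-x) hxy)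
    (by simpa [sub_eq_add_neg] using M.le_add (-x) hyz)
  have hsub : p (z - x) ≤ p z + p x := map_sub_le_add p z x
  have hadd : p y ≤ p (y - x) + p x := by simpa using map_add_le_add p (y - x) x
  linarith [hA x hx, hA z hz]

end MixedLattice

universe u in
/-- a locally convex topology on a topological mixed lattice space is
locally mixed-full if and only if it is generated by a family of mixed-monotone
seminorms (the seminorm balls form a neighborhood base at zero). -/
theorem stmt_12 {V : Type u} [AddCommGroup V] [Module ℝ V] (M : MixedLattice V)
    [TopologicalSpace V] [ContinuousAdd V] [ContinuousSMul ℝ V]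
    [LocallyConvexSpace ℝ V]
    (hup : Continuous fun p : V × V => M.up p.1 p.2)
    (hdown : Continuous fun p : V × V => M.down p.1 p.2) :
    M.LocallyMixedFull ↔
      ∃ (ι : Type u) (p : ι → Seminorm ℝ V),
        (∀ i, ∀ x y : V, M.sle 0 x → M.le x y → p i x ≤ p i y) ∧
        (∀ U : Set V, U ∈ nhds (0 : V) ↔
          ∃ (S : Finset ι) (ε : ℝ), 0 < ε ∧ {x : V | ∀ i ∈ S, p i x < ε} ⊆ U) := by
  have : ContinuousNeg V := ContinuousNeg.of_continuousConstSMul ℝ V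
  have : IsTopologicalAddGroup V := {}
  constructor
  · intro h
    refine ⟨{p : Seminorm ℝ V // Continuous p ∧ ∀ x y : V, M.sle 0 x → M.le x y → p x ≤ p y},
      Subtype.val, fun i => i.2.2, fun U => ⟨fun hU => ?_, ?_⟩⟩
    · obtain ⟨p, hpc, hpm, hpU⟩ := h.exists_seminorm hU
      exact ⟨{⟨p, hpc, hpm⟩}, 1, one_pos, by simpa using hpU⟩
    · rintro ⟨S, ε, hε, hSU⟩
      refine Filter.mem_of_superset ((Filter.eventually_all_finset S).2 fun i _ => ?_) hSU
      exact i.2.1.continuousAt.eventually_lt continuousAt_const (by simpa using hε)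
  · rintro ⟨ι, p, hp, hbasis⟩ U hU
    obtain ⟨S, ε, hε, hSU⟩ := (hbasis U).1 hU
    refine ⟨M.MF1 {x : V | ∀ i ∈ S, p i x < ε / 3}, ?_, fun y hy => hSU fun i hi => ?_,
      M.MF1_MF1 _⟩
    · exact (hbasis _).2 ⟨S, ε / 3, by positivity, M.subset_MF1 _⟩
    · have := M.seminorm_lt_of_mem_MF1 (hp i) (A := {x | ∀ i ∈ S, p i x < ε / 3})
        (fun x hx => hx i hi) hy
      linarith
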